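/- Let 1 < p < ∞, fix α with n + 1/p < α < n + 1, and let μ be a positive Borel measure on 𝒰 satisfying ∫_𝒰 |wₙ + i|^{−α₀} dμ(w) < ∞ for some α₀ > 0. Suppose there exists C > 0 such that for every f ∈ 𝒮_α the function T_μ f(z) = ∫_𝒰 K(z,w) f(w) dμ(w) satisfies ‖T_μ f‖ₚ ≤ C ‖f‖ₚ (i.e. T_μ is bounded on the dense subspace 𝒮_α of Aᵖ(𝒰)). Then the Berezin transform of μ is bounded: sup_{z ∈ 𝒰} ρ(z)^{n+1} ∫_𝒰 |ρ(z,w)|^{−2(n+1)} dμ(w) < ∞. -/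

import Mathlib

open MeasureTheory Filter

noncomputable section

/-- Points of ℂⁿ written `z = (z′, zₙ)` with `z′ ∈ ℂ^m`, `m = n - 1`. -/
abbrev SPoint (m : ℕ) := (Fin m → ℂ) × ℂ

/-- `ρ(z,w) = (i/2)(w̄ₙ − zₙ) − z′·w̄′`. -/
def srho2 {m : ℕ} (z w : SPoint m) : ℂ :=
  Complex.I / 2 * ((starRingEnd ℂ) w.2 - z.2) - ∑ j, z.1 j * (starRingEnd ℂ) (w.1 j)

/-- `ρ(z) = Im zₙ − |z′|²`. -/
def srho {m : ℕ} (z : SPoint m) : ℝ :=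
  z.2.im - ∑ j, ‖z.1 j‖ ^ 2

/-- The Siegel upper half-space `𝒰 = {z : ρ(z) > 0}`. -/
def Siegel (m : ℕ) : Set (SPoint m) := {z | 0 < srho z}

/-- The Bergman kernel `K(z,w) = (n!/(4πⁿ)) ρ(z,w)^{−(n+1)}` (points in ℂⁿ = ℂ^{n-1} × ℂ). -/
def sK (n : ℕ) (z w : SPoint (n - 1)) : ℂ :=
  (n.factorial : ℂ) / (4 * (Real.pi : ℂ) ^ n) * srho2 z w ^ (-(n + 1 : ℤ))

/-- Inverse hyperbolic tangent. -/
def artanh (x : ℝ) : ℝ := (1 / 2) * Real.log ((1 + x) / (1 - x))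

/-- The Bergman distance `β(z,w) = artanh √(1 − ρ(z)ρ(w)/|ρ(z,w)|²)`. -/
def sbeta {m : ℕ} (z w : SPoint m) : ℝ :=
  artanh (Real.sqrt (1 - srho z * srho w / ‖srho2 z w‖ ^ 2))

/-- The Bergman metric ball `D(z,r)`. -/
def sball {m : ℕ} (z : SPoint m) (r : ℝ) : Set (SPoint m) :=
  {w ∈ Siegel m | sbeta z w < r}

/-- Membership in the Bergman space `Aᵖ(𝒰)`: holomorphic with `∫_𝒰 |f|ᵖ dV < ∞`. -/
def MemAp (n : ℕ) (p : ℝ) (f : SPoint (n - 1) → ℂ) : Prop :=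
  DifferentiableOn ℂ f (Siegel (n - 1)) ∧
    IntegrableOn (fun z => ‖f z‖ ^ p) (Siegel (n - 1)) volume

/-- `‖f‖ₚ = (∫_𝒰 |f|ᵖ dV)^{1/p}`. -/
def bNorm (n : ℕ) (p : ℝ) (f : SPoint (n - 1) → ℂ) : ℝ :=
  (∫ z in Siegel (n - 1), ‖f z‖ ^ p) ^ (1 / p)

/-- The space `𝒮_α` of holomorphic `f` on `𝒰` with `sup_z |zₙ + i|^α |f(z)| < ∞`. -/
def SAlpha (n : ℕ) (α : ℝ) (f : SPoint (n - 1) → ℂ) : Prop :=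
  DifferentiableOn ℂ f (Siegel (n - 1)) ∧
    ∃ M : ℝ, ∀ z ∈ Siegel (n - 1), ‖z.2 + Complex.I‖ ^ α * ‖f z‖ ≤ M

end

noncomputable section

/-- The iterated forward difference of `W ↦ W⁻ᵐ` with unit step. -/
noncomputable def invPowDiff (k m : ℕ) : ℂ → ℂ := (fwdDiff 1)^[k] (fun W => (W ^ m)⁻¹)

lemma invPowDiff_succ (k m : ℕ) (W : ℂ) :
    invPowDiff (k + 1) m W = invPowDiff k m (W + 1) - invPowDiff k m W := by
  simp only [invPowDiff, Function.iterate_succ_apply', fwdDiff]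

lemma invPowDiff_eq_sum (k m : ℕ) (W : ℂ) :
    invPowDiff k m W = ∑ j ∈ Finset.range (k + 1),
      (((-1 : ℝ) ^ (k - j) * (k.choose j : ℝ) : ℝ) : ℂ) * ((W + j) ^ m)⁻¹ := by
  rw [invPowDiff, fwdDiff_iter_eq_sum_shift]
  refine Finset.sum_congr rfl fun j _ => ?_
  simp

lemma invPowDiff_conj (k m : ℕ) (W : ℂ) :
    invPowDiff k m (starRingEnd ℂ W) = starRingEnd ℂ (invPowDiff k m W) := by
  simp [invPowDiff_eq_sum, map_sum]

lemma hasDerivAt_invPowDiff (k m : ℕ) {W : ℂ} (hW : 0 < W.re) :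
    HasDerivAt (invPowDiff k m) (-(m : ℂ) * invPowDiff k (m + 1) W) W := by
  induction k generalizing W with
  | zero =>
    have h0 : W ≠ 0 := by rintro rfl; simp at hW
    have h := (hasDerivAt_pow m W).inv (pow_ne_zero m h0)
    refine h.congr_deriv ?_
    simp only [invPowDiff, Function.iterate_zero, id]
    rcases m with _ | m
    · simp
    · simp only [Nat.add_sub_cancel]
      field_simp
      ring
  | succ k ih =>
    have h1 : HasDerivAt (fun V => invPowDiff k m (V + 1)) _ W :=
      (ih (W := W + 1) (by simp; linarith)).comp_add_const W 1
    have h := h1.sub (ih hW)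
    have e : invPowDiff (k + 1) m = (fun V => invPowDiff k m (V + 1)) - invPowDiff k m := by
      ext V; simp [invPowDiff_succ]
    rw [e]
    refine h.congr_deriv ?_
    rw [invPowDiff_succ]; ring

lemma norm_le_norm_add_of_re_pos {W : ℂ} (hW : 0 < W.re) {t : ℝ} (ht : 0 ≤ t) :
    ‖W‖ ≤ ‖W + t‖ := by
  rw [← sq_le_sq₀ (norm_nonneg _) (norm_nonneg _), Complex.sq_norm, Complex.sq_norm,
    Complex.normSq_apply, Complex.normSq_apply]
  simp only [Complex.add_re, Complex.ofReal_re, Complex.add_im, Complex.ofReal_im, add_zero]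
  nlinarith

lemma exists_norm_invPowDiff_le (k m : ℕ) :
    ∃ C : ℝ, 0 ≤ C ∧ ∀ W : ℂ, 0 < W.re → ‖invPowDiff k m W‖ ≤ C * (‖W‖ ^ (m + k))⁻¹ := by
  induction k generalizing m with
  | zero => exact ⟨1, zero_le_one, fun W _ => by simp [invPowDiff]⟩
  | succ k ih =>
    obtain ⟨C, hC0, hC⟩ := ih (m + 1)
    refine ⟨m * C, by positivity, fun W hW => ?_⟩
    have hWn : 0 < ‖W‖ := norm_pos_iff.2 (by rintro rfl; simp at hW)
    have hre : ∀ t : ℝ, 0 ≤ t → 0 < (W + t).re := fun t ht => by simp; linarith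
    have hd : ∀ t ∈ Set.Icc (0 : ℝ) 1, HasDerivWithinAt (fun t : ℝ => invPowDiff k m (W + t))
        (-(m : ℂ) * invPowDiff k (m + 1) (W + t)) (Set.Icc 0 1) t := fun t ht => by
      have h1 := hasDerivAt_invPowDiff k m (hre t ht.1)
      have h2 : HasDerivAt (fun s : ℝ => W + (s : ℂ)) 1 t :=
        (Complex.ofRealCLM.hasDerivAt (x := t)).const_add W |>.congr_deriv (by simp)
      simpa [Function.comp_def] using (h1.scomp t h2).hasDerivWithinAt
    have hb : ∀ t ∈ Set.Ico (0 : ℝ) 1,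
        ‖-(m : ℂ) * invPowDiff k (m + 1) (W + t)‖ ≤ m * C * (‖W‖ ^ (m + (k + 1)))⁻¹ :=
      fun t ht => by
        rw [norm_mul, norm_neg, Complex.norm_natCast, mul_assoc]
        gcongr
        refine (hC _ (hre t ht.1)).trans ?_
        have := norm_le_norm_add_of_re_pos hW ht.1
        rw [show m + 1 + k = m + (k + 1) by ring]
        gcongr
    have := norm_image_sub_le_of_norm_deriv_le_segment' hd hb 1 (by simp)
    rw [invPowDiff_succ]
    simpa using this

lemma invPowDiff_re_pos (k m : ℕ) (hm : 1 ≤ m) (x : ℝ) (hx : 0 < x) :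
    0 < (-1) ^ k * (invPowDiff k m x).re := by
  induction k generalizing m x with
  | zero =>
    simp only [invPowDiff, Function.iterate_zero, id, pow_zero, one_mul]
    rw [← Complex.ofReal_pow, ← Complex.ofReal_inv, Complex.ofReal_re]
    positivity
  | succ k ih =>
    have hd : ∀ y : ℝ, 0 < y → HasDerivAt (fun t : ℝ => (-1) ^ k * (invPowDiff k m t).re)
        ((-1) ^ k * (-(m : ℂ) * invPowDiff k (m + 1) y).re) y := fun y hy =>
      ((hasDerivAt_invPowDiff k m (W := y) (by simpa)).real_of_complex).const_mul _
    have hanti : StrictAntiOn (fun t : ℝ => (-1) ^ k * (invPowDiff k m t).re) (Set.Ioi 0) := by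
      refine strictAntiOn_of_deriv_neg (convex_Ioi 0)
        (fun y hy => (hd y hy).continuousAt.continuousWithinAt) fun y hy => ?_
      rw [interior_Ioi] at hy
      rw [(hd y hy).deriv]
      have h1 := ih (m + 1) (by omega) y hy
      have h2 : (-(m : ℂ) * invPowDiff k (m + 1) y).re = -(m * (invPowDiff k (m + 1) y).re) := by
        simp
      rw [h2]
      have : (0 : ℝ) < m := by exact_mod_cast hm
      nlinarith
    have := hanti (a := x) (b := x + 1) hx (by simp; linarith) (by linarith)
    simp only at this
    rw [invPowDiff_succ, Complex.sub_re, pow_succ]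
    push_cast at this ⊢
    linarith

lemma srho2_conj {m : ℕ} (z w : SPoint m) : starRingEnd ℂ (srho2 z w) = srho2 w z := by
  simp only [srho2, map_sub, map_mul, map_sum, map_div₀, Complex.conj_I, Complex.conj_conj,
    map_ofNat]
  rw [show -Complex.I / 2 * (w.2 - starRingEnd ℂ z.2) =
    Complex.I / 2 * (starRingEnd ℂ z.2 - w.2) by ring]
  exact congrArg _ (Finset.sum_congr rfl fun j _ => mul_comm _ _)

lemma norm_srho2_comm {m : ℕ} (z w : SPoint m) : ‖srho2 z w‖ = ‖srho2 w z‖ := by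
  rw [← srho2_conj, RCLike.norm_conj]

lemma srho2_re {m : ℕ} (z w : SPoint m) :
    (srho2 z w).re = (srho z + srho w + ∑ j, ‖z.1 j - w.1 j‖ ^ 2) / 2 := by
  have h : ∀ j, ‖z.1 j - w.1 j‖ ^ 2 =
      ‖z.1 j‖ ^ 2 + ‖w.1 j‖ ^ 2 - 2 * (z.1 j * starRingEnd ℂ (w.1 j)).re := fun j => by
    simp only [Complex.sq_norm, Complex.normSq_apply, Complex.mul_re, Complex.conj_re,
      Complex.conj_im, Complex.sub_re, Complex.sub_im]
    ring
  have h1 : (Complex.I / 2 * (starRingEnd ℂ w.2 - z.2)).re = (w.2.im + z.2.im) / 2 := by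
    simp [Complex.mul_re, Complex.div_ofNat_re, Complex.div_ofNat_im]
    ring
  simp only [h, srho2, srho, Complex.sub_re, Complex.re_sum, h1, Finset.sum_sub_distrib,
    Finset.sum_add_distrib, ← Finset.mul_sum]
  ring

lemma srho_le_two_norm_srho2 {m : ℕ} (z : SPoint m) {w : SPoint m} (hw : 0 < srho w) :
    srho z ≤ 2 * ‖srho2 z w‖ := by
  have h := srho2_re z w
  have h2 := Complex.re_le_norm (srho2 z w)
  have : 0 ≤ ∑ j, ‖z.1 j - w.1 j‖ ^ 2 := Finset.sum_nonneg fun j _ => by positivity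
  linarith

lemma srho2_re_pos {m : ℕ} {z w : SPoint m} (hz : 0 < srho z) (hw : 0 < srho w) :
    0 < (srho2 z w).re := by
  rw [srho2_re]
  positivity

lemma srho2_ne_zero {m : ℕ} {z w : SPoint m} (hz : 0 < srho z) (hw : 0 < srho w) :
    srho2 z w ≠ 0 := fun h => by
  have := srho2_re_pos hz hw
  simp [h] at this

lemma srho2_self {m : ℕ} (z : SPoint m) : srho2 z z = srho z := by
  apply Complex.ext
  · rw [srho2_re]; simp
  · have := congrArg Complex.im (srho2_conj z z)
    simp only [Complex.conj_im] at this
    simp; linarith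

/-- The zero of the affine function `wₙ ↦ ρ(w, z)`. -/
def srhoCenter {m : ℕ} (z : SPoint m) (v : Fin m → ℂ) : ℂ :=
  starRingEnd ℂ z.2 + 2 * Complex.I * ∑ j, v j * starRingEnd ℂ (z.1 j)

lemma srho2_eq_sub_center {m : ℕ} (z w : SPoint m) :
    srho2 w z = -(Complex.I / 2) * (w.2 - srhoCenter z w.1) := by
  simp only [srho2, srhoCenter]
  linear_combination -(∑ j, w.1 j * starRingEnd ℂ (z.1 j)) * Complex.I_sq

lemma norm_sub_center {m : ℕ} (z w : SPoint m) :
    ‖w.2 - srhoCenter z w.1‖ = 2 * ‖srho2 z w‖ := by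
  rw [norm_srho2_comm, srho2_eq_sub_center, norm_mul, norm_neg, norm_div, Complex.norm_I]
  simp

/-- Vertical translation of the last coordinate. -/
def vshift {m : ℕ} (z : SPoint m) (t : ℝ) : SPoint m := (z.1, z.2 + 2 * Complex.I * t)

lemma srho_vshift {m : ℕ} (z : SPoint m) (t : ℝ) : srho (vshift z t) = srho z + 2 * t := by
  simp [srho, vshift]
  ring

lemma srho2_vshift {m : ℕ} (z w : SPoint m) (t : ℝ) :
    srho2 (vshift z t) w = srho2 z w + t := by
  simp only [srho2, vshift]
  linear_combination -(t : ℂ) * Complex.I_sq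

/-- A circular neighbourhood of the origin adapted to the geometry of the Siegel domain at `w`. -/
def sbox {m : ℕ} (w : SPoint m) (t : ℝ) : Set (SPoint m) :=
  {v | ‖v.2 - 2 * Complex.I * ∑ j, v.1 j * starRingEnd ℂ (w.1 j)‖ < t * srho w ∧
    ∑ j, ‖v.1 j‖ ^ 2 < t ^ 2 * srho w}

lemma srho_add {m : ℕ} (w v : SPoint m) :
    srho (w + v) = srho w + (v.2 - 2 * Complex.I * ∑ j, v.1 j * starRingEnd ℂ (w.1 j)).im
      - ∑ j, ‖v.1 j‖ ^ 2 := by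
  have h : ∀ j, ‖w.1 j + v.1 j‖ ^ 2 =
      ‖w.1 j‖ ^ 2 + ‖v.1 j‖ ^ 2 + 2 * (v.1 j * starRingEnd ℂ (w.1 j)).re := fun j => by
    simp only [Complex.sq_norm, Complex.normSq_apply, Complex.mul_re, Complex.conj_re,
      Complex.conj_im, Complex.add_re, Complex.add_im]
    ring
  have h2 : (2 * Complex.I * ∑ j, v.1 j * starRingEnd ℂ (w.1 j)).im =
      2 * ∑ j, (v.1 j * starRingEnd ℂ (w.1 j)).re := by
    rw [mul_assoc, Complex.mul_im, Complex.I_mul_re, Complex.I_mul_im, Complex.re_sum]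
    simp
  rw [Complex.sub_im, h2]
  simp only [srho, Prod.fst_add, Prod.snd_add, Pi.add_apply, h, Finset.sum_add_distrib,
    ← Finset.mul_sum, Complex.add_im]
  ring

lemma abs_srho_add_sub_le {m : ℕ} {w v : SPoint m} {t : ℝ} (ht : 0 < t) (ht1 : t ≤ 1)
    (hv : v ∈ sbox w t) : |srho (w + v) - srho w| ≤ 2 * t * srho w := by
  obtain ⟨h1, h2⟩ := hv
  have hw : 0 < srho w := pos_of_mul_pos_right ((norm_nonneg _).trans_lt h1) ht.le
  have h0 : 0 ≤ ∑ j, ‖v.1 j‖ ^ 2 := Finset.sum_nonneg fun j _ => by positivity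
  have h3 := (Complex.abs_im_le_norm _).trans h1.le
  have h4 : t ^ 2 * srho w ≤ t * srho w := by gcongr; nlinarith
  rw [srho_add, abs_le]
  rw [abs_le] at h3
  constructor <;> linarith [h3.1, h3.2]

lemma srho2_add_sub {m : ℕ} (z w v : SPoint m) :
    srho2 (w + v) z - srho2 w z =
      -(Complex.I / 2) * (v.2 - 2 * Complex.I * ∑ j, v.1 j * starRingEnd ℂ (w.1 j))
      + ∑ j, v.1 j * starRingEnd ℂ (w.1 j - z.1 j) := by
  simp only [srho2, Prod.fst_add, Prod.snd_add, Pi.add_apply, map_sub, mul_sub, add_mul,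
    Finset.sum_add_distrib, Finset.sum_sub_distrib]
  linear_combination -(∑ j, v.1 j * starRingEnd ℂ (w.1 j)) * Complex.I_sq

lemma norm_srho2_add_sub_le {m : ℕ} {z w v : SPoint m} (hz : 0 < srho z) {t : ℝ} (ht : 0 < t)
    (hv : v ∈ sbox w t) : ‖srho2 z (w + v) - srho2 z w‖ ≤ 2 * t * ‖srho2 z w‖ := by
  obtain ⟨h1, h2⟩ := hv
  rw [← srho2_conj (w + v) z, ← srho2_conj w z, ← map_sub, RCLike.norm_conj, RCLike.norm_conj,
    srho2_add_sub]
  have hre := srho2_re w z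
  have hn := Complex.re_le_norm (srho2 w z)
  have h3 : ‖∑ j, v.1 j * starRingEnd ℂ (w.1 j - z.1 j)‖ ≤
      (∑ j, ‖v.1 j‖ ^ 2) / (2 * t) + t / 2 * ∑ j, ‖w.1 j - z.1 j‖ ^ 2 := by
    rw [Finset.sum_div, Finset.mul_sum, ← Finset.sum_add_distrib]
    refine (norm_sum_le _ _).trans (Finset.sum_le_sum fun j _ => ?_)
    rw [norm_mul, RCLike.norm_conj]
    have := sq_nonneg (‖v.1 j‖ - t * ‖w.1 j - z.1 j‖)
    rw [← sub_nonneg]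
    have e : ‖v.1 j‖ ^ 2 / (2 * t) + t / 2 * ‖w.1 j - z.1 j‖ ^ 2 - ‖v.1 j‖ * ‖w.1 j - z.1 j‖ =
        (‖v.1 j‖ - t * ‖w.1 j - z.1 j‖) ^ 2 / (2 * t) := by
      field_simp
      ring
    rw [e]; positivity
  have h4 : (∑ j, ‖v.1 j‖ ^ 2) / (2 * t) ≤ t / 2 * srho w := by
    rw [div_le_iff₀ (by positivity)]
    linarith
  have h5 : ‖-(Complex.I / 2) * (v.2 - 2 * Complex.I * ∑ j, v.1 j * starRingEnd ℂ (w.1 j))‖ ≤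
      t / 2 * srho w := by
    rw [norm_mul, norm_neg, norm_div, Complex.norm_I]
    simp only [Complex.norm_ofNat]
    linarith
  refine (norm_add_le _ _).trans ?_
  nlinarith [Finset.sum_nonneg (s := Finset.univ) (f := fun j => ‖w.1 j - z.1 j‖ ^ 2)
    fun j _ => by positivity]

/-- For fixed `z`, the modulus of `ρ(z, w)` dominates that of `wₙ + i`. -/
lemma exists_norm_add_I_le {m : ℕ} (z : SPoint m) (hz : 0 < srho z) :
    ∃ A : ℝ, 0 < A ∧ ∀ w : SPoint m, 0 < srho w → ‖w.2 + Complex.I‖ ≤ A * ‖srho2 z w‖ := by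
  set B : ℝ := ‖z.2‖ + 3 * ∑ j, ‖z.1 j‖ ^ 2 + 1 with hB
  have hS : 0 ≤ ∑ j, ‖z.1 j‖ ^ 2 := Finset.sum_nonneg fun j _ => by positivity
  have hB0 : 0 < B := by positivity
  refine ⟨4 + B * (2 / srho z), by positivity, fun w hw => ?_⟩
  have h1 := norm_sub_center z w
  have h2 : ‖srhoCenter z w.1‖ + 1 ≤ B + 2 * ‖srho2 z w‖ := by
    have hd : ∑ j, ‖z.1 j - w.1 j‖ ^ 2 ≤ 2 * ‖srho2 z w‖ := by
      have := srho2_re z w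
      have := Complex.re_le_norm (srho2 z w)
      linarith
    have hs : ‖∑ j, w.1 j * starRingEnd ℂ (z.1 j)‖ ≤
        ∑ j, (‖z.1 j - w.1 j‖ ^ 2 / 2 + 3 / 2 * ‖z.1 j‖ ^ 2) := by
      refine (norm_sum_le _ _).trans (Finset.sum_le_sum fun j _ => ?_)
      rw [norm_mul, RCLike.norm_conj]
      have : ‖w.1 j‖ ≤ ‖z.1 j - w.1 j‖ + ‖z.1 j‖ := by
        have := norm_sub_norm_le (w.1 j) (z.1 j)
        rw [norm_sub_rev] at this
        linarith
      nlinarith [sq_nonneg (‖z.1 j - w.1 j‖ - ‖z.1 j‖), norm_nonneg (z.1 j)]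
    rw [Finset.sum_add_distrib, ← Finset.sum_div, ← Finset.mul_sum] at hs
    have := norm_add_le (starRingEnd ℂ z.2) (2 * Complex.I * ∑ j, w.1 j * starRingEnd ℂ (z.1 j))
    rw [norm_mul, norm_mul, Complex.norm_I, RCLike.norm_conj] at this
    simp only [Complex.norm_ofNat] at this
    rw [srhoCenter]
    linarith
  have h3 : 1 ≤ 2 / srho z * ‖srho2 z w‖ := by
    have := srho_le_two_norm_srho2 z hw
    rw [div_mul_eq_mul_div, le_div_iff₀ hz]
    linarith
  have h4 : ‖w.2 + Complex.I‖ ≤ ‖w.2 - srhoCenter z w.1‖ + (‖srhoCenter z w.1‖ + 1) := by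
    have := norm_add₃_le (a := w.2 - srhoCenter z w.1) (b := srhoCenter z w.1) (c := Complex.I)
    rw [sub_add_cancel, Complex.norm_I] at this
    linarith
  nlinarith

lemma one_le_norm_add_I {m : ℕ} {w : SPoint m} (hw : 0 < srho w) : 1 ≤ ‖w.2 + Complex.I‖ := by
  have h := (le_abs_self _).trans (Complex.abs_im_le_norm (w.2 + Complex.I))
  have h0 : 0 ≤ ∑ j, ‖w.1 j‖ ^ 2 := Finset.sum_nonneg fun j _ => by positivity
  simp only [Complex.add_im, Complex.I_im] at h
  unfold srho at hw
  linarith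

lemma continuous_srho {m : ℕ} : Continuous (srho : SPoint m → ℝ) := by
  unfold srho; fun_prop

lemma continuous_srho2 {m : ℕ} : Continuous fun q : SPoint m × SPoint m => srho2 q.1 q.2 := by
  unfold srho2; fun_prop

lemma isOpen_siegel (m : ℕ) : IsOpen (Siegel m) := isOpen_lt continuous_const continuous_srho

lemma differentiable_srho2 {m : ℕ} (z : SPoint m) : Differentiable ℂ fun w => srho2 w z := by
  unfold srho2; fun_prop

lemma lintegral_one_add_norm_div {E : Type*} [NormedAddCommGroup E] [NormedSpace ℝ E]
    [MeasurableSpace E] [BorelSpace E] [FiniteDimensional ℝ E] (ν : Measure E)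
    [ν.IsAddHaarMeasure] (k : ℕ) {r : ℝ} (hr : 0 < r) :
    ∫⁻ x : E, ENNReal.ofReal (((1 + ‖x‖ / r) ^ k)⁻¹) ∂ν =
      ENNReal.ofReal (r ^ Module.finrank ℝ E) * ∫⁻ x : E, ENNReal.ofReal (((1 + ‖x‖) ^ k)⁻¹) ∂ν := by
  have h := congrArg (fun η => ∫⁻ x : E, ENNReal.ofReal (((1 + ‖x‖) ^ k)⁻¹) ∂η)
    (Measure.map_addHaar_smul ν (inv_ne_zero hr.ne'))
  rw [lintegral_map (by fun_prop) (by fun_prop), lintegral_smul_measure] at h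
  rw [abs_of_pos (by positivity), inv_pow, inv_inv, smul_eq_mul] at h
  rw [← h]
  refine lintegral_congr fun x => ?_
  rw [norm_smul, norm_inv, Real.norm_of_nonneg hr.le, div_eq_inv_mul]

lemma lintegral_one_add_norm_pow_lt_top {E : Type*} [NormedAddCommGroup E] [NormedSpace ℝ E]
    [MeasurableSpace E] [BorelSpace E] [FiniteDimensional ℝ E] (ν : Measure E)
    [ν.IsAddHaarMeasure] {k : ℕ} (hk : Module.finrank ℝ E < k) :
    ∫⁻ x : E, ENNReal.ofReal (((1 + ‖x‖) ^ k)⁻¹) ∂ν < ⊤ := by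
  have h := finite_integral_one_add_norm (μ := ν) (r := (k : ℝ)) (by exact_mod_cast hk)
  refine lt_of_eq_of_lt (lintegral_congr fun x => ?_) h
  rw [Real.rpow_neg (by positivity), Real.rpow_natCast]

lemma inv_norm_srho2_pow_le {m : ℕ} {z w : SPoint m} (hz : 0 < srho z) (hw : 0 < srho w) :
    (‖srho2 z w‖ ^ (2 * (m + 2)))⁻¹ ≤ (8 / srho z) ^ (2 * (m + 2)) *
      (((1 + ‖w.1 - z.1‖ / √(srho z)) ^ (4 * m + 2))⁻¹ *
        ((1 + ‖w.2 - srhoCenter z w.1‖ / srho z) ^ 3)⁻¹) := by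
  set R := srho z
  set X := ‖srho2 z w‖
  set a := ‖w.2 - srhoCenter z w.1‖ / R with ha
  set b := ‖w.1 - z.1‖ / √R with hb
  have hX : R ≤ 2 * X := srho_le_two_norm_srho2 z hw
  have hX0 : 0 < X := by linarith
  have ha0 : 0 ≤ a := by positivity
  have hb0 : 0 ≤ b := by positivity
  have haR : a * R = 2 * X := by
    rw [ha, div_mul_cancel₀ _ hz.ne', norm_sub_center]
  have hbR : b ^ 2 * R ≤ 2 * X := by
    rw [hb, div_pow, Real.sq_sqrt hz.le, div_mul_cancel₀ _ hz.ne']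
    have h1 : ‖w.1 - z.1‖ ≤ √(∑ j, ‖z.1 j - w.1 j‖ ^ 2) := by
      refine (pi_norm_le_iff_of_nonneg (Real.sqrt_nonneg _)).2 fun j => Real.le_sqrt_of_sq_le ?_
      rw [Pi.sub_apply, norm_sub_rev]
      exact Finset.single_le_sum (f := fun j => ‖z.1 j - w.1 j‖ ^ 2)
        (fun i _ => by positivity) (Finset.mem_univ j)
    have h2 : ‖w.1 - z.1‖ ^ 2 ≤ ∑ j, ‖z.1 j - w.1 j‖ ^ 2 := by
      rw [← Real.le_sqrt (norm_nonneg _) (Finset.sum_nonneg fun j _ => by positivity)]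
      exact h1
    have := srho2_re z w
    have := Complex.re_le_norm (srho2 z w)
    linarith
  have h1 : R / 8 * (1 + a) ≤ X := by linarith
  have h2 : R / 8 * (1 + b) ^ 2 ≤ X := by nlinarith [sq_nonneg (b - 1)]
  have h3 : (R / 8) ^ (2 * (m + 2)) * ((1 + b) ^ (4 * m + 2) * (1 + a) ^ 3) ≤
      X ^ (2 * (m + 2)) := by
    calc _ = (R / 8 * (1 + b) ^ 2) ^ (2 * m + 1) * (R / 8 * (1 + a)) ^ 3 := by
          rw [mul_pow _ _ (2 * m + 1), ← pow_mul (1 + b)]; ring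
      _ ≤ X ^ (2 * m + 1) * X ^ 3 := by gcongr
      _ = _ := by ring
  calc (X ^ (2 * (m + 2)))⁻¹
      ≤ ((R / 8) ^ (2 * (m + 2)) * ((1 + b) ^ (4 * m + 2) * (1 + a) ^ 3))⁻¹ := by gcongr
    _ = _ := by rw [mul_inv, mul_inv, ← inv_pow, inv_div]

lemma continuous_srhoCenter {m : ℕ} (z : SPoint m) : Continuous (srhoCenter z) := by
  unfold srhoCenter; fun_prop

lemma exists_lintegral_inv_norm_srho2_le (m : ℕ) :
    ∃ A : ℝ, 0 ≤ A ∧ ∀ z : SPoint m, 0 < srho z →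
      ∫⁻ w in Siegel m, ENNReal.ofReal ((‖srho2 z w‖ ^ (2 * (m + 2)))⁻¹) ≤
        ENNReal.ofReal (A * (srho z ^ (m + 2))⁻¹) := by
  set I₁ := ∫⁻ x : Fin m → ℂ, ENNReal.ofReal (((1 + ‖x‖) ^ (4 * m + 2))⁻¹) with hI₁
  set I₂ := ∫⁻ x : ℂ, ENNReal.ofReal (((1 + ‖x‖) ^ 3)⁻¹) with hI₂
  have hfin : Module.finrank ℝ (Fin m → ℂ) = 2 * m := by
    rw [Module.finrank_pi_fintype]; simp [Complex.finrank_real_complex, mul_comm]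
  have h1 : I₁ ≠ ⊤ := (lintegral_one_add_norm_pow_lt_top _ (by rw [hfin]; omega)).ne
  have h2 : I₂ ≠ ⊤ := (lintegral_one_add_norm_pow_lt_top _
    (by rw [Complex.finrank_real_complex]; norm_num)).ne
  refine ⟨8 ^ (2 * (m + 2)) * (I₁.toReal * I₂.toReal), by positivity, fun z hz => ?_⟩
  have hc := continuous_srhoCenter z
  calc ∫⁻ w in Siegel m, ENNReal.ofReal ((‖srho2 z w‖ ^ (2 * (m + 2)))⁻¹)
      ≤ ∫⁻ w in Siegel m, ENNReal.ofReal ((8 / srho z) ^ (2 * (m + 2))) *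
          (ENNReal.ofReal (((1 + ‖w.1 - z.1‖ / √(srho z)) ^ (4 * m + 2))⁻¹) *
            ENNReal.ofReal (((1 + ‖w.2 - srhoCenter z w.1‖ / srho z) ^ 3)⁻¹)) := by
        refine setLIntegral_mono' (isOpen_siegel m).measurableSet fun w hw => ?_
        rw [← ENNReal.ofReal_mul (by positivity), ← ENNReal.ofReal_mul (by positivity)]
        exact ENNReal.ofReal_le_ofReal (inv_norm_srho2_pow_le hz hw)
    _ ≤ ∫⁻ w : SPoint m, ENNReal.ofReal ((8 / srho z) ^ (2 * (m + 2))) *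
          (ENNReal.ofReal (((1 + ‖w.1 - z.1‖ / √(srho z)) ^ (4 * m + 2))⁻¹) *
            ENNReal.ofReal (((1 + ‖w.2 - srhoCenter z w.1‖ / srho z) ^ 3)⁻¹)) :=
        setLIntegral_le_lintegral _ _
    _ = ENNReal.ofReal ((8 / srho z) ^ (2 * (m + 2))) *
          (ENNReal.ofReal (√(srho z) ^ (2 * m)) * I₁ * (ENNReal.ofReal (srho z ^ 2) * I₂)) := by
        have hmeas : Measurable fun w : SPoint m =>
            ENNReal.ofReal (((1 + ‖w.1 - z.1‖ / √(srho z)) ^ (4 * m + 2))⁻¹) *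
            ENNReal.ofReal (((1 + ‖w.2 - srhoCenter z w.1‖ / srho z) ^ 3)⁻¹) := by
          have := hc.measurable
          fun_prop
        rw [lintegral_const_mul _ hmeas, Measure.volume_eq_prod, lintegral_prod _ hmeas.aemeasurable]
        congr 1
        have inner : ∀ v : Fin m → ℂ, ∫⁻ y : ℂ,
            ENNReal.ofReal (((1 + ‖v - z.1‖ / √(srho z)) ^ (4 * m + 2))⁻¹) *
            ENNReal.ofReal (((1 + ‖y - srhoCenter z v‖ / srho z) ^ 3)⁻¹) =
            ENNReal.ofReal (((1 + ‖v - z.1‖ / √(srho z)) ^ (4 * m + 2))⁻¹) *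
              (ENNReal.ofReal (srho z ^ 2) * I₂) := fun v => by
          rw [lintegral_const_mul _ (by fun_prop),
            lintegral_sub_right_eq_self
              (fun y : ℂ => ENNReal.ofReal (((1 + ‖y‖ / srho z) ^ 3)⁻¹)) (srhoCenter z v),
            lintegral_one_add_norm_div _ _ hz, Complex.finrank_real_complex]
        simp only [inner]
        rw [lintegral_mul_const _ (by fun_prop),
          lintegral_sub_right_eq_self
            (fun y : Fin m → ℂ => ENNReal.ofReal (((1 + ‖y‖ / √(srho z)) ^ (4 * m + 2))⁻¹)) z.1,
          lintegral_one_add_norm_div _ _ (Real.sqrt_pos.2 hz), hfin]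
    _ = ENNReal.ofReal (8 ^ (2 * (m + 2)) * (I₁.toReal * I₂.toReal) * (srho z ^ (m + 2))⁻¹) := by
        rw [← ENNReal.ofReal_toReal h1, ← ENNReal.ofReal_toReal h2, pow_mul √(srho z),
          Real.sq_sqrt hz.le,
          ← ENNReal.ofReal_mul (by positivity), ← ENNReal.ofReal_mul (by positivity),
          ← ENNReal.ofReal_mul (by positivity), ← ENNReal.ofReal_mul (by positivity),
          ENNReal.toReal_ofReal (by positivity), ENNReal.toReal_ofReal (by positivity)]
        congr 1
        rw [div_pow]
        field_simp
        ring

lemma measurableSet_sbox {m : ℕ} (w : SPoint m) (t : ℝ) : MeasurableSet (sbox w t) := by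
  simp only [sbox, Set.ofPred_and]
  exact ((isOpen_lt (by fun_prop) (by fun_prop)).inter
    (isOpen_lt (by fun_prop) (by fun_prop))).measurableSet

lemma exists_le_volume_sbox (m : ℕ) {t : ℝ} (ht : 0 < t) :
    ∃ c : ℝ, 0 < c ∧ ∀ w : SPoint m, 0 < srho w →
      ENNReal.ofReal (c * srho w ^ (m + 2)) ≤ volume (sbox w t) := by
  refine ⟨(t ^ 2 / (m + 1) * Real.pi) ^ m * (t ^ 2 * Real.pi), by positivity, fun w hw => ?_⟩
  set r : ℝ := √(t ^ 2 * srho w / (m + 1)) with hr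
  have hr0 : 0 < r := by positivity
  have hr2 : r ^ 2 = t ^ 2 * srho w / (m + 1) := Real.sq_sqrt (by positivity)
  have hball : ∀ v ∈ Metric.ball (0 : Fin m → ℂ) r, ∑ j, ‖v j‖ ^ 2 < t ^ 2 * srho w := by
    intro v hv
    rw [mem_ball_zero_iff] at hv
    calc ∑ j, ‖v j‖ ^ 2 ≤ ∑ _j : Fin m, r ^ 2 := by
          refine Finset.sum_le_sum fun j _ => ?_
          gcongr
          exact (norm_le_pi_norm v j).trans hv.le
      _ = m * (t ^ 2 * srho w / (m + 1)) := by simp [hr2]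
      _ < (m + 1) * (t ^ 2 * srho w / (m + 1)) := by gcongr; linarith
      _ = _ := by field_simp
  rw [Measure.volume_eq_prod, Measure.prod_apply (measurableSet_sbox w t)]
  calc ENNReal.ofReal ((t ^ 2 / (m + 1) * Real.pi) ^ m * (t ^ 2 * Real.pi) * srho w ^ (m + 2))
      = ∫⁻ _ in Metric.ball (0 : Fin m → ℂ) r, volume (Metric.ball (0 : ℂ) (t * srho w)) := by
        rw [setLIntegral_const, volume_pi_ball _ hr0]
        simp only [Pi.zero_apply, Complex.volume_ball, Finset.prod_const, Finset.card_univ,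
          Fintype.card_fin]
        rw [← ENNReal.ofReal_coe_nnreal, ← ENNReal.ofReal_pow (by positivity),
          ← ENNReal.ofReal_pow hr0.le, ← ENNReal.ofReal_mul (by positivity),
          ← ENNReal.ofReal_mul (by positivity), ← ENNReal.ofReal_pow (by positivity),
          ← ENNReal.ofReal_mul (by positivity), hr2, NNReal.coe_real_pi]
        congr 1
        ring
    _ ≤ ∫⁻ v in Metric.ball (0 : Fin m → ℂ) r, volume (Prod.mk v ⁻¹' sbox w t) := by
        refine setLIntegral_mono' measurableSet_ball fun v hv => ?_
        rw [← measure_preimage_add_right volume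
          (-(2 * Complex.I * ∑ j, v j * starRingEnd ℂ (w.1 j))) (Metric.ball (0 : ℂ) (t * srho w))]
        refine measure_mono fun y hy => ⟨?_, hball v hv⟩
        simpa [dist_eq_norm] using hy
    _ ≤ _ := setLIntegral_le_lintegral _ _


lemma volume_preserving_circle_smul {m : ℕ} (e : Circle) :
    MeasurePreserving (fun v : SPoint m => (e : ℂ) • v) volume volume := by
  have h : MeasurePreserving (fun y : ℂ => (e : ℂ) • y) volume volume :=
    (rotation e).measurePreserving
  exact (volume_preserving_pi (fun _ : Fin m => h)).prod h

lemma smul_mem_sbox {m : ℕ} {w v : SPoint m} {t : ℝ} (hv : v ∈ sbox w t) {s : ℂ}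
    (hs : ‖s‖ ≤ 1) : s • v ∈ sbox w t := by
  obtain ⟨h1, h2⟩ := hv
  constructor
  · refine lt_of_le_of_lt ?_ h1
    have : (s • v).2 - 2 * Complex.I * ∑ j, (s • v).1 j * starRingEnd ℂ (w.1 j) =
        s * (v.2 - 2 * Complex.I * ∑ j, v.1 j * starRingEnd ℂ (w.1 j)) := by
      simp only [Prod.smul_fst, Prod.smul_snd, Pi.smul_apply, smul_eq_mul, mul_assoc,
        ← Finset.mul_sum]
      ring
    rw [this, norm_mul]
    exact mul_le_of_le_one_left (norm_nonneg _) hs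
  · refine lt_of_le_of_lt (Finset.sum_le_sum fun j _ => ?_) h2
    simp only [Prod.smul_fst, Pi.smul_apply, smul_eq_mul, norm_mul]
    gcongr
    exact mul_le_of_le_one_left (norm_nonneg _) hs

lemma add_mem_siegel_of_mem_sbox {m : ℕ} {w v : SPoint m} {t : ℝ} (ht : 0 < t) (ht4 : t ≤ 1 / 4)
    (hw : 0 < srho w) (hv : v ∈ sbox w t) : 0 < srho (w + v) := by
  have h := abs_srho_add_sub_le ht (by linarith) hv
  rw [abs_le] at h
  nlinarith [h.1]

/-- The uniform probability measure on the angular interval `(0, 2π]`. -/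
def angleMeasure : Measure ℝ :=
  (ENNReal.ofReal (2 * Real.pi))⁻¹ • volume.restrict (Set.Ioc 0 (2 * Real.pi))

instance : IsProbabilityMeasure angleMeasure := by
  constructor
  simp only [angleMeasure, Measure.smul_apply, smul_eq_mul, Measure.restrict_apply_univ,
    Real.volume_Ioc, sub_zero]
  exact ENNReal.inv_mul_cancel (by simp [Real.pi_pos]) ENNReal.ofReal_ne_top

lemma circleAverage_eq_integral_angleMeasure (g : ℂ → ℂ) :
    Real.circleAverage g 0 1 = ∫ θ, g (circleMap 0 1 θ) ∂angleMeasure := by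
  rw [Real.circleAverage, intervalIntegral.integral_of_le (by positivity), angleMeasure,
    integral_smul_measure, ENNReal.toReal_inv, ENNReal.toReal_ofReal (by positivity)]

lemma enorm_rpow_le_lintegral_circle {m : ℕ} {F : SPoint m → ℂ}
    (hF : DifferentiableOn ℂ F (Siegel m)) {p : ℝ} (hp : 1 ≤ p) {ζ v : SPoint m}
    (hv : ∀ s : ℂ, ‖s‖ ≤ 1 → ζ + s • v ∈ Siegel m) :
    ‖F ζ‖ₑ ^ p ≤ ∫⁻ θ, ‖F (ζ + circleMap 0 1 θ • v)‖ₑ ^ p ∂angleMeasure := by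
  set g : ℂ → ℂ := fun s => F (ζ + s • v) with hg
  have hgd : ∀ s : ℂ, ‖s‖ ≤ 1 → DifferentiableAt ℂ g s := fun s hs => by
    have h1 := hF.differentiableAt ((isOpen_siegel m).mem_nhds (hv s hs))
    exact h1.comp s (by fun_prop)
  have havg : Real.circleAverage g 0 1 = g 0 := by
    refine circleAverage_of_differentiable_on_off_countable Set.countable_empty ?_ ?_
    · intro s hs
      exact (hgd s (by simpa using hs)).continuousAt.continuousWithinAt
    · intro s hs
      exact hgd s (by simpa using (Metric.ball_subset_closedBall hs.1))
  have hcont : Continuous fun θ : ℝ => g (circleMap 0 1 θ) := by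
    refine continuous_iff_continuousAt.2 fun θ => ?_
    exact (hgd _ (by simp)).continuousAt.comp (continuous_circleMap 0 1).continuousAt
  rw [circleAverage_eq_integral_angleMeasure] at havg
  have h1 : ‖F ζ‖ₑ ≤ ∫⁻ θ, ‖g (circleMap 0 1 θ)‖ₑ ∂angleMeasure := by
    have : F ζ = g 0 := by simp [hg]
    rw [this, ← havg]
    exact enorm_integral_le_lintegral_enorm _
  have h2 := eLpNorm_le_eLpNorm_of_exponent_le (p := 1) (q := ENNReal.ofReal p)
    (μ := angleMeasure) (f := fun θ : ℝ => g (circleMap 0 1 θ))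
    (by simpa using hp) hcont.aestronglyMeasurable
  rw [eLpNorm_one_eq_lintegral_enorm, eLpNorm_eq_lintegral_rpow_enorm_toReal (by simp; linarith)
    ENNReal.ofReal_ne_top, ENNReal.toReal_ofReal (by linarith)] at h2
  have h3 := ENNReal.rpow_le_rpow (h1.trans h2) (z := p) (by linarith)
  rwa [← ENNReal.rpow_mul, one_div_mul_cancel (by linarith), ENNReal.rpow_one] at h3

lemma enorm_rpow_mul_volume_sbox_le {m : ℕ} {F : SPoint m → ℂ}
    (hF : DifferentiableOn ℂ F (Siegel m)) {p : ℝ} (hp : 1 ≤ p) {ζ : SPoint m}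
    (hζ : 0 < srho ζ) :
    ‖F ζ‖ₑ ^ p * volume (sbox ζ (1 / 4)) ≤ ∫⁻ w in Siegel m, ‖F w‖ₑ ^ p := by
  have hU := (isOpen_siegel m).measurableSet
  have : (volume : Measure (SPoint m)).IsAddLeftInvariant := by
    rw [Measure.volume_eq_prod]; exact Measure.prod.instIsAddLeftInvariant
  set g : SPoint m → ENNReal := (Siegel m).indicator fun w => ‖F w‖ₑ ^ p with hg
  have hgm : Measurable g := by
    classical
    have h1 : Measurable ((Siegel m).piecewise F 0) :=
      hF.continuousOn.measurable_piecewise continuous_zero.continuousOn hU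
    have h2 : g = (Siegel m).indicator fun w => ‖(Siegel m).piecewise F 0 w‖ₑ ^ p :=
      Set.indicator_congr fun w hw => by rw [Set.piecewise_eq_of_mem _ _ _ hw]
    rw [h2]
    exact (h1.enorm.pow_const p).indicator hU
  have hmem : ∀ v ∈ sbox ζ (1 / 4), ∀ s : ℂ, ‖s‖ ≤ 1 → ζ + s • v ∈ Siegel m := fun v hv s hs =>
    add_mem_siegel_of_mem_sbox (by norm_num) le_rfl hζ (smul_mem_sbox hv hs)
  calc ‖F ζ‖ₑ ^ p * volume (sbox ζ (1 / 4))
      = ∫⁻ _ in sbox ζ (1 / 4), ‖F ζ‖ₑ ^ p := (setLIntegral_const _ _).symm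
    _ ≤ ∫⁻ v in sbox ζ (1 / 4), ∫⁻ θ, g (ζ + circleMap 0 1 θ • v) ∂angleMeasure := by
        refine setLIntegral_mono' (measurableSet_sbox _ _) fun v hv => ?_
        refine (enorm_rpow_le_lintegral_circle hF hp (hmem v hv)).trans
          (lintegral_mono fun θ => ?_)
        rw [hg, Set.indicator_of_mem (hmem v hv _ (by simp))]
    _ ≤ ∫⁻ v : SPoint m, ∫⁻ θ, g (ζ + circleMap 0 1 θ • v) ∂angleMeasure :=
        setLIntegral_le_lintegral _ _
    _ = ∫⁻ θ, (∫⁻ v : SPoint m, g (ζ + circleMap 0 1 θ • v)) ∂angleMeasure := by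
        refine lintegral_lintegral_swap (Measurable.aemeasurable ?_)
        refine hgm.comp (Continuous.measurable ?_)
        have := continuous_circleMap 0 1
        fun_prop
    _ = ∫⁻ _, (∫⁻ v : SPoint m, g v) ∂angleMeasure := by
        refine lintegral_congr fun θ => ?_
        rw [← lintegral_add_left_eq_self g ζ]
        have h := (volume_preserving_circle_smul (m := m) (Circle.exp θ)).lintegral_comp
          (hgm.comp (measurable_const_add ζ))
        simpa [circleMap, Circle.coe_exp] using h
    _ = ∫⁻ w in Siegel m, ‖F w‖ₑ ^ p := by
        rw [lintegral_const, measure_univ, mul_one, hg, lintegral_indicator hU]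

/-- A rapidly decaying linear combination of kernel functions concentrated near `z`. -/
def testFun {m : ℕ} (k : ℕ) (z w : SPoint m) : ℂ := invPowDiff k (m + 2) (srho2 w z / srho z)

lemma srho2_div_re_pos {m : ℕ} {z w : SPoint m} (hz : 0 < srho z) (hw : 0 < srho w) :
    0 < (srho2 w z / srho z).re := by
  rw [Complex.div_ofReal_re]
  exact div_pos (srho2_re_pos hw hz) hz

lemma exists_norm_testFun_le (m k : ℕ) :
    ∃ A : ℝ, 0 ≤ A ∧ ∀ z w : SPoint m, 0 < srho z → 0 < srho w →
      ‖testFun k z w‖ ≤ A * (srho z / ‖srho2 z w‖) ^ (m + 2 + k) := by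
  obtain ⟨A, hA0, hA⟩ := exists_norm_invPowDiff_le k (m + 2)
  refine ⟨A, hA0, fun z w hz hw => (hA _ (srho2_div_re_pos hz hw)).trans_eq ?_⟩
  rw [norm_div, Complex.norm_of_nonneg hz.le, norm_srho2_comm, ← inv_pow, inv_div]

lemma differentiableOn_testFun {m : ℕ} (k : ℕ) {z : SPoint m} (hz : 0 < srho z) :
    DifferentiableOn ℂ (testFun k z) (Siegel m) := by
  intro w hw
  have h : DifferentiableAt ℂ (fun w => srho2 w z / (srho z : ℂ)) w := by
    simp only [div_eq_mul_inv]
    exact (differentiable_srho2 z w).mul_const _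
  exact ((hasDerivAt_invPowDiff k (m + 2)
    (srho2_div_re_pos hz hw)).differentiableAt.comp w h).differentiableWithinAt

lemma sAlpha_testFun {m k : ℕ} {α : ℝ} (hα : α ≤ (m + 2 + k : ℕ)) {z : SPoint m}
    (hz : 0 < srho z) : SAlpha (m + 1) α (testFun k z) := by
  obtain ⟨A, hA0, hA⟩ := exists_norm_testFun_le m k
  obtain ⟨B, hB0, hB⟩ := exists_norm_add_I_le z hz
  refine ⟨differentiableOn_testFun k hz, A * (B * srho z) ^ (m + 2 + k), fun w hw => ?_⟩
  have hX : 0 < ‖srho2 z w‖ := norm_pos_iff.2 (srho2_ne_zero hz hw)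
  have h1 : ‖w.2 + Complex.I‖ ^ α ≤ (B * ‖srho2 z w‖) ^ (m + 2 + k) := by
    calc ‖w.2 + Complex.I‖ ^ α ≤ ‖w.2 + Complex.I‖ ^ ((m + 2 + k : ℕ) : ℝ) :=
          Real.rpow_le_rpow_of_exponent_le (one_le_norm_add_I hw) hα
      _ = ‖w.2 + Complex.I‖ ^ (m + 2 + k) := Real.rpow_natCast _ _
      _ ≤ _ := by gcongr; exact hB w hw
  calc ‖w.2 + Complex.I‖ ^ α * ‖testFun k z w‖
      ≤ (B * ‖srho2 z w‖) ^ (m + 2 + k) * (A * (srho z / ‖srho2 z w‖) ^ (m + 2 + k)) := by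
        gcongr
        exact hA z w hz hw
    _ = A * (B * ‖srho2 z w‖ * (srho z / ‖srho2 z w‖)) ^ (m + 2 + k) := by
        rw [mul_pow _ (srho z / _)]; ring
    _ = _ := by congr 2; field_simp

lemma exists_bNorm_testFun_le (m : ℕ) {k : ℕ} (hk : m + 2 ≤ k) {p : ℝ} (hp : 1 < p) :
    ∃ A : ℝ, 0 ≤ A ∧ ∀ z : SPoint m, 0 < srho z →
      bNorm (m + 1) p (testFun k z) ≤ (A * srho z ^ (m + 2)) ^ (1 / p) := by
  obtain ⟨A, hA0, hA⟩ := exists_norm_testFun_le m k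
  obtain ⟨D, hD0, hD⟩ := exists_lintegral_inv_norm_srho2_le m
  set N := m + 2 + k with hN
  set E : ℝ := (A * 2 ^ N) ^ p with hE
  have hE0 : 0 ≤ E := by positivity
  refine ⟨E * D, by positivity, fun z hz => ?_⟩
  have hpt : ∀ w ∈ Siegel m, ‖testFun k z w‖ ^ p ≤
      E * srho z ^ (2 * (m + 2)) * (‖srho2 z w‖ ^ (2 * (m + 2)))⁻¹ := by
    intro w hw
    have hX : 0 < ‖srho2 z w‖ := norm_pos_iff.2 (srho2_ne_zero hz hw)
    set x := srho z / (2 * ‖srho2 z w‖) with hx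
    have hx0 : 0 < x := by positivity
    have hx1 : x ≤ 1 := by
      rw [hx, div_le_one (by positivity)]
      exact srho_le_two_norm_srho2 z hw
    have h1 : ‖testFun k z w‖ ≤ A * 2 ^ N * x ^ (2 * (m + 2)) := by
      calc _ ≤ A * (srho z / ‖srho2 z w‖) ^ N := hA z w hz hw
        _ = A * (2 * x) ^ N := by congr 2; rw [hx]; field_simp
        _ = A * 2 ^ N * x ^ N := by rw [mul_pow]; ring
        _ ≤ _ := by
          gcongr A * 2 ^ N * ?_
          exact pow_le_pow_of_le_one hx0.le hx1 (by omega)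
    calc ‖testFun k z w‖ ^ p ≤ (A * 2 ^ N * x ^ (2 * (m + 2))) ^ p := by gcongr
      _ = E * (x ^ (2 * (m + 2))) ^ p := Real.mul_rpow (by positivity) (by positivity)
      _ ≤ E * x ^ (2 * (m + 2)) := by
          gcongr
          have := Real.rpow_le_rpow_of_exponent_ge (x := x ^ (2 * (m + 2))) (by positivity)
            (pow_le_one₀ hx0.le hx1) hp.le
          rwa [Real.rpow_one] at this
      _ ≤ E * (srho z / ‖srho2 z w‖) ^ (2 * (m + 2)) := by
          gcongr
          rw [hx]
          gcongr
          linarith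
      _ = _ := by rw [div_pow]; ring
  unfold bNorm
  refine Real.rpow_le_rpow (integral_nonneg fun w => by positivity) ?_ (by positivity)
  rw [← ENNReal.ofReal_le_ofReal_iff (by positivity)]
  calc ENNReal.ofReal (∫ w in Siegel m, ‖testFun k z w‖ ^ p)
      = ‖∫ w in Siegel m, ‖testFun k z w‖ ^ p‖ₑ :=
        (Real.enorm_of_nonneg (integral_nonneg fun w => by positivity)).symm
    _ ≤ ∫⁻ w in Siegel m, ‖‖testFun k z w‖ ^ p‖ₑ := enorm_integral_le_lintegral_enorm _
    _ ≤ ∫⁻ w in Siegel m, ENNReal.ofReal (E * srho z ^ (2 * (m + 2))) *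
          ENNReal.ofReal ((‖srho2 z w‖ ^ (2 * (m + 2)))⁻¹) := by
        refine setLIntegral_mono' (isOpen_siegel m).measurableSet fun w hw => ?_
        rw [Real.enorm_of_nonneg (by positivity), ← ENNReal.ofReal_mul (by positivity)]
        exact ENNReal.ofReal_le_ofReal (hpt w hw)
    _ ≤ ENNReal.ofReal (E * srho z ^ (2 * (m + 2))) *
          ENNReal.ofReal (D * (srho z ^ (m + 2))⁻¹) := by
        rw [lintegral_const_mul' _ _ ENNReal.ofReal_ne_top]
        gcongr
        exact hD z hz
    _ = _ := by
        rw [← ENNReal.ofReal_mul (by positivity)]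
        congr 1
        field_simp
        ring

lemma exists_norm_le_bNorm (m : ℕ) {p : ℝ} (hp : 1 < p) :
    ∃ c : ℝ, 0 < c ∧ ∀ F : SPoint m → ℂ, MemAp (m + 1) p F → ∀ ζ : SPoint m, 0 < srho ζ →
      (c * srho ζ ^ (m + 2)) ^ (1 / p) * ‖F ζ‖ ≤ bNorm (m + 1) p F := by
  obtain ⟨c, hc0, hc⟩ := exists_le_volume_sbox m (t := 1 / 4) (by norm_num)
  refine ⟨c, hc0, fun F hF ζ hζ => ?_⟩
  have hp0 : 0 < p := by linarith
  have he : ∀ w, ‖F w‖ₑ ^ p = ENNReal.ofReal (‖F w‖ ^ p) := fun w => by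
    rw [← ENNReal.ofReal_rpow_of_nonneg (norm_nonneg _) hp0.le, ofReal_norm]
  have hint : IntegrableOn (fun w => ‖F w‖ ^ p) (Siegel m) volume := hF.2
  have h1 : ENNReal.ofReal (‖F ζ‖ ^ p * (c * srho ζ ^ (m + 2))) ≤
      ENNReal.ofReal (∫ w in Siegel m, ‖F w‖ ^ p) := by
    rw [ofReal_integral_eq_lintegral_ofReal hint (ae_of_all _ fun w => by positivity),
      ENNReal.ofReal_mul (by positivity)]
    refine le_trans ?_ ((enorm_rpow_mul_volume_sbox_le hF.1 hp.le hζ).trans_eq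
      (lintegral_congr fun w => he w))
    rw [he]
    gcongr
    exact hc ζ hζ
  rw [ENNReal.ofReal_le_ofReal_iff (integral_nonneg fun w => by positivity)] at h1
  have h2 := Real.rpow_le_rpow (by positivity) h1 (z := 1 / p) (by positivity)
  rw [Real.mul_rpow (by positivity) (by positivity), ← Real.rpow_mul (norm_nonneg _),
    mul_one_div_cancel hp0.ne', Real.rpow_one] at h2
  rw [mul_comm]
  exact h2

lemma exists_le_norm_invPowDiff (k m : ℕ) (hm : 1 ≤ m) :
    ∃ ε δ : ℝ, 0 < ε ∧ 0 < δ ∧ ∀ W : ℂ, ‖W - 1‖ < δ → ε ≤ ‖invPowDiff k m W‖ := by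
  have h0 : 0 < ‖invPowDiff k m 1‖ := by
    have h := invPowDiff_re_pos k m hm 1 one_pos
    refine norm_pos_iff.2 fun h1 => ?_
    simp [h1] at h
  have hc : ContinuousAt (fun W => ‖invPowDiff k m W‖) 1 :=
    (hasDerivAt_invPowDiff k m (W := 1) (by simp)).continuousAt.norm
  have hev := hc.eventually_mem (Ioi_mem_nhds (half_lt_self h0))
  obtain ⟨δ, hδ, h⟩ := Metric.eventually_nhds_iff.1 hev
  exact ⟨_, δ, half_pos h0, hδ, fun W hW => (h (by simpa [dist_eq_norm] using hW)).le⟩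

/-- The normalising constant `n! / (4πⁿ)` of the Bergman kernel. -/
def kernelConst (n : ℕ) : ℝ := n.factorial / (4 * Real.pi ^ n)

lemma kernelConst_pos (n : ℕ) : 0 < kernelConst n := by
  unfold kernelConst
  positivity

lemma sK_eq {m : ℕ} (z w : SPoint m) :
    sK (m + 1) z w = kernelConst (m + 1) * (srho2 z w ^ (m + 2))⁻¹ := by
  have h : (-(((m + 1 : ℕ) : ℤ) + 1)) = -((m + 2 : ℕ) : ℤ) := by push_cast; ring
  rw [sK, h, zpow_neg, zpow_natCast, kernelConst]
  push_cast
  rfl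

lemma norm_sK_le {m : ℕ} {ζ w : SPoint m} (hζ : 0 < srho ζ) (hw : 0 < srho w) :
    ‖sK (m + 1) ζ w‖ ≤ kernelConst (m + 1) * ((srho ζ / 2) ^ (m + 2))⁻¹ := by
  rw [sK_eq, norm_mul, norm_inv, norm_pow, Complex.norm_of_nonneg (kernelConst_pos _).le]
  have := srho_le_two_norm_srho2 ζ hw
  have := kernelConst_pos (m + 1)
  gcongr
  linarith

lemma continuousOn_sK {m : ℕ} {ζ : SPoint m} (hζ : 0 < srho ζ) :
    ContinuousOn (fun w : SPoint m => sK (m + 1) ζ w) (Siegel m) := by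
  simp only [sK_eq]
  refine continuousOn_const.mul (ContinuousOn.inv₀ (ContinuousOn.pow ?_ _) fun w hw =>
    pow_ne_zero _ (srho2_ne_zero hζ hw))
  exact (continuous_srho2.comp (by fun_prop : Continuous fun w : SPoint m => (ζ, w))).continuousOn

lemma sum_sK_vshift_mul_testFun {m k : ℕ} {z w : SPoint m} (hz : 0 < srho z) :
    ∑ j ∈ Finset.range (k + 1), (((-1 : ℝ) ^ (k - j) * (k.choose j : ℝ) : ℝ) : ℂ) *
        (sK (m + 1) (vshift z (j * srho z)) w * testFun k z w) =
      ((kernelConst (m + 1) * (srho z ^ (m + 2))⁻¹ * ‖testFun k z w‖ ^ 2 : ℝ) : ℂ) := by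
  have hz' : (srho z : ℂ) ≠ 0 := by exact_mod_cast hz.ne'
  have h1 : ∀ j : ℕ, sK (m + 1) (vshift z (j * srho z)) w =
      kernelConst (m + 1) * (srho z ^ (m + 2) : ℂ)⁻¹ *
        ((starRingEnd ℂ (srho2 w z / srho z) + j) ^ (m + 2))⁻¹ := fun j => by
    rw [sK_eq, srho2_vshift, map_div₀, srho2_conj, Complex.conj_ofReal, mul_assoc, ← mul_inv,
      ← mul_pow]
    congr 3
    push_cast
    field_simp
  have h2 : ∀ j : ℕ, (((-1 : ℝ) ^ (k - j) * (k.choose j : ℝ) : ℝ) : ℂ) *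
        (sK (m + 1) (vshift z (j * srho z)) w * testFun k z w) =
      kernelConst (m + 1) * (srho z ^ (m + 2) : ℂ)⁻¹ * testFun k z w *
        ((((-1 : ℝ) ^ (k - j) * (k.choose j : ℝ) : ℝ) : ℂ) *
        ((starRingEnd ℂ (srho2 w z / srho z) + j) ^ (m + 2))⁻¹) := fun j => by
    rw [h1]; ring
  simp only [h2]
  rw [← Finset.mul_sum, ← invPowDiff_eq_sum, invPowDiff_conj, ← testFun, mul_assoc,
    Complex.mul_conj, Complex.normSq_eq_norm_sq]
  push_cast
  rfl

lemma integrableOn_sK_mul_testFun {m k : ℕ} {μ : Measure (SPoint m)} {α : ℝ}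
    (hα : α ≤ (m + 2 + k : ℕ))
    (hμ : ∫⁻ w in Siegel m, ENNReal.ofReal (‖w.2 + Complex.I‖ ^ (-α)) ∂μ < ⊤)
    {ζ z : SPoint m} (hζ : 0 < srho ζ) (hz : 0 < srho z) :
    IntegrableOn (fun w => sK (m + 1) ζ w * testFun k z w) (Siegel m) μ := by
  have hU := (isOpen_siegel m).measurableSet
  obtain ⟨hd, M, hM⟩ := sAlpha_testFun hα hz
  have hcont : ContinuousOn (fun w => sK (m + 1) ζ w * testFun k z w) (Siegel m) :=
    (continuousOn_sK hζ).mul (differentiableOn_testFun k hz).continuousOn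
  refine ⟨hcont.aestronglyMeasurable hU, ?_⟩
  set D := kernelConst (m + 1) * ((srho ζ / 2) ^ (m + 2))⁻¹
  have hD : 0 ≤ D := by
    have := kernelConst_pos (m + 1)
    positivity
  refine lt_of_le_of_lt (b := ENNReal.ofReal (D * M) *
    ∫⁻ w in Siegel m, ENNReal.ofReal (‖w.2 + Complex.I‖ ^ (-α)) ∂μ) ?_
    (ENNReal.mul_lt_top ENNReal.ofReal_lt_top hμ)
  rw [← lintegral_const_mul' _ _ ENNReal.ofReal_ne_top]
  refine setLIntegral_mono' hU fun w hw => ?_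
  have hx : 0 < ‖w.2 + Complex.I‖ := one_pos.trans_le (one_le_norm_add_I hw)
  have hM' : ‖testFun k z w‖ ≤ M * ‖w.2 + Complex.I‖ ^ (-α) := by
    rw [Real.rpow_neg hx.le, ← div_eq_mul_inv, le_div_iff₀ (by positivity), mul_comm]
    exact hM w hw
  have hM0 : 0 ≤ M := (by positivity : (0 : ℝ) ≤ _).trans (hM w hw)
  rw [← ofReal_norm, ← ENNReal.ofReal_mul (by positivity), norm_mul, mul_assoc]
  gcongr
  exact norm_sK_le hζ hw

/-- Boundedness of the Toeplitz operator controls the square mass of the test functions. -/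
lemma exists_lintegral_sq_testFun_le {m k : ℕ} {p α α₀ C : ℝ} (hp : 1 < p) (hC : 0 < C)
    (hα : α ≤ (m + 2 + k : ℕ)) (hα₀ : α₀ ≤ (m + 2 + k : ℕ)) (hk : m + 2 ≤ k)
    {μ : Measure (SPoint m)}
    (hμ : ∫⁻ w in Siegel m, ENNReal.ofReal (‖w.2 + Complex.I‖ ^ (-α₀)) ∂μ < ⊤)
    (hT : ∀ f : SPoint m → ℂ, SAlpha (m + 1) α f →
      MemAp (m + 1) p (fun z => ∫ w in Siegel m, sK (m + 1) z w * f w ∂μ) ∧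
        bNorm (m + 1) p (fun z => ∫ w in Siegel m, sK (m + 1) z w * f w ∂μ) ≤
          C * bNorm (m + 1) p f) :
    ∃ B : ℝ, 0 ≤ B ∧ ∀ z : SPoint m, 0 < srho z →
      ∫⁻ w in Siegel m, ENNReal.ofReal (‖testFun k z w‖ ^ 2) ∂μ ≤
        ENNReal.ofReal (B * srho z ^ (m + 2)) := by
  obtain ⟨A, hA0, hA⟩ := exists_bNorm_testFun_le m hk hp
  obtain ⟨c, hc0, hc⟩ := exists_norm_le_bNorm m hp
  have hκ := kernelConst_pos (m + 1)
  have hp0 : 0 < p := by linarith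
  set G : ℝ := C * (A / c) ^ (1 / p) with hG
  set S : ℝ := ∑ j ∈ Finset.range (k + 1), |(-1 : ℝ) ^ (k - j) * (k.choose j : ℝ)| with hS
  have hS0 : 0 ≤ S := Finset.sum_nonneg fun j _ => abs_nonneg _
  refine ⟨(kernelConst (m + 1))⁻¹ * (S * G), by positivity, fun z hz => ?_⟩
  set F : SPoint m → ℂ := fun ζ => ∫ w in Siegel m, sK (m + 1) ζ w * testFun k z w ∂μ with hF
  obtain ⟨hFm, hFn⟩ := hT _ (sAlpha_testFun hα hz)
  have hζ : ∀ j : ℕ, srho z ≤ srho (vshift z (j * srho z)) := fun j => by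
    rw [srho_vshift]
    have : 0 ≤ (j : ℝ) * srho z := by positivity
    linarith
  have hFb : ∀ j : ℕ, ‖F (vshift z (j * srho z))‖ ≤ G := fun j => by
    have h1 : (c * srho z ^ (m + 2)) ^ (1 / p) * ‖F (vshift z (j * srho z))‖ ≤
        C * (A * srho z ^ (m + 2)) ^ (1 / p) := by
      calc _ ≤ (c * srho (vshift z (j * srho z)) ^ (m + 2)) ^ (1 / p) *
            ‖F (vshift z (j * srho z))‖ := by
            gcongr
            exact hζ j
        _ ≤ _ := hc F hFm _ (hz.trans_le (hζ j))
        _ ≤ _ := hFn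
        _ ≤ _ := by gcongr; exact hA z hz
    rw [← le_div_iff₀' (by positivity), mul_div_assoc,
      ← Real.div_rpow (by positivity) (by positivity), mul_div_mul_right _ _ (by positivity)] at h1
    exact h1
  have hint : ∀ j : ℕ, IntegrableOn (fun w : SPoint m =>
      (((-1 : ℝ) ^ (k - j) * (k.choose j : ℝ) : ℝ) : ℂ) *
        (sK (m + 1) (vshift z (j * srho z)) w * testFun k z w)) (Siegel m) μ := fun j =>
    (integrableOn_sK_mul_testFun hα₀ hμ (hz.trans_le (hζ j)) hz).const_mul _
  have hsum : ∑ j ∈ Finset.range (k + 1), (((-1 : ℝ) ^ (k - j) * (k.choose j : ℝ) : ℝ) : ℂ) *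
      F (vshift z (j * srho z)) = ((∫ w in Siegel m,
        kernelConst (m + 1) * (srho z ^ (m + 2))⁻¹ * ‖testFun k z w‖ ^ 2 ∂μ : ℝ) : ℂ) := by
    rw [← integral_complex_ofReal]
    simp only [← sum_sK_vshift_mul_testFun hz]
    rw [integral_finsetSum _ fun j _ => hint j]
    refine Finset.sum_congr rfl fun j _ => ?_
    rw [integral_const_mul]
  have hintR : IntegrableOn (fun w => kernelConst (m + 1) * (srho z ^ (m + 2))⁻¹ *
      ‖testFun k z w‖ ^ 2) (Siegel m) μ := by
    have h : IntegrableOn (fun w => ((kernelConst (m + 1) * (srho z ^ (m + 2))⁻¹ *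
        ‖testFun k z w‖ ^ 2 : ℝ) : ℂ)) (Siegel m) μ := by
      simp only [← sum_sK_vshift_mul_testFun hz]
      exact integrable_finsetSum _ fun j _ => hint j
    exact h.re
  have hbd : ∫ w in Siegel m, kernelConst (m + 1) * (srho z ^ (m + 2))⁻¹ *
      ‖testFun k z w‖ ^ 2 ∂μ ≤ S * G := by
    refine (le_abs_self _).trans ?_
    rw [← Real.norm_eq_abs, ← Complex.norm_real, ← hsum, hS, Finset.sum_mul]
    refine (norm_sum_le _ _).trans (Finset.sum_le_sum fun j _ => ?_)
    rw [norm_mul, Complex.norm_real, Real.norm_eq_abs]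
    gcongr
    exact hFb j
  have hE := ofReal_integral_eq_lintegral_ofReal hintR (ae_of_all _ fun w => by positivity)
  have hsplit : ∀ w, ENNReal.ofReal (‖testFun k z w‖ ^ 2) =
      ENNReal.ofReal ((kernelConst (m + 1))⁻¹ * srho z ^ (m + 2)) *
        ENNReal.ofReal (kernelConst (m + 1) * (srho z ^ (m + 2))⁻¹ * ‖testFun k z w‖ ^ 2) :=
    fun w => by
      rw [← ENNReal.ofReal_mul (by positivity)]
      congr 1
      field_simp
  simp only [hsplit]
  rw [lintegral_const_mul' _ _ ENNReal.ofReal_ne_top, ← hE, ← ENNReal.ofReal_mul (by positivity)]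
  refine ENNReal.ofReal_le_ofReal ?_
  calc _ ≤ (kernelConst (m + 1))⁻¹ * srho z ^ (m + 2) * (S * G) := by gcongr
    _ = _ := by ring

lemma exists_measure_near_le {m k : ℕ} {B : ℝ} (hB : 0 ≤ B) {ν : Measure (SPoint m)}
    (h : ∀ z : SPoint m, 0 < srho z →
      ∫⁻ w, ENNReal.ofReal (‖testFun k z w‖ ^ 2) ∂ν ≤ ENNReal.ofReal (B * srho z ^ (m + 2))) :
    ∃ δ D : ℝ, 0 < δ ∧ 0 ≤ D ∧ ∀ z : SPoint m, 0 < srho z →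
      ν {w | ‖srho2 w z - srho z‖ < δ * srho z} ≤ ENNReal.ofReal (D * srho z ^ (m + 2)) := by
  obtain ⟨ε, δ, hε, hδ, hεδ⟩ := exists_le_norm_invPowDiff k (m + 2) (by omega)
  refine ⟨δ, (ε ^ 2)⁻¹ * B, hδ, by positivity, fun z hz => ?_⟩
  set N : Set (SPoint m) := {w | ‖srho2 w z - srho z‖ < δ * srho z} with hN
  have hz' : (srho z : ℂ) ≠ 0 := by exact_mod_cast hz.ne'
  have hNm : MeasurableSet N := by
    have : Continuous fun w : SPoint m => srho2 w z := (differentiable_srho2 z).continuous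
    exact (isOpen_lt (by fun_prop) continuous_const).measurableSet
  have h1 : ENNReal.ofReal (ε ^ 2) * ν N ≤ ENNReal.ofReal (B * srho z ^ (m + 2)) := by
    rw [← setLIntegral_const]
    refine (setLIntegral_mono' hNm fun w hw => ?_).trans ((setLIntegral_le_lintegral _ _).trans
      (h z hz))
    refine ENNReal.ofReal_le_ofReal ?_
    gcongr
    refine hεδ _ ?_
    rw [div_sub_one hz', norm_div, Complex.norm_of_nonneg hz.le, div_lt_iff₀ hz]
    exact hw
  calc ν N = ENNReal.ofReal ((ε ^ 2)⁻¹) * (ENNReal.ofReal (ε ^ 2) * ν N) := by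
        rw [← mul_assoc, ← ENNReal.ofReal_mul (by positivity), inv_mul_cancel₀ (by positivity),
          ENNReal.ofReal_one, one_mul]
    _ ≤ ENNReal.ofReal ((ε ^ 2)⁻¹) * ENNReal.ofReal (B * srho z ^ (m + 2)) := by gcongr
    _ = _ := by rw [← ENNReal.ofReal_mul (by positivity), mul_assoc]

/-- Averaging over a small neighbourhood of `w` dominates the kernel power at `w`. -/
lemma exists_le_lintegral_near (m : ℕ) {δ : ℝ} (hδ : 0 < δ) :
    ∃ c : ℝ, 0 < c ∧ ∀ z w : SPoint m, 0 < srho z → 0 < srho w →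
      ENNReal.ofReal (c * (‖srho2 z w‖ ^ (2 * (m + 2)))⁻¹) ≤
        ∫⁻ ζ, {ζ : SPoint m | 0 < srho ζ ∧ ‖srho2 w ζ - srho ζ‖ < δ * srho ζ}.indicator
          (fun ζ => ENNReal.ofReal ((srho ζ ^ (m + 2))⁻¹ * (‖srho2 z ζ‖ ^ (2 * (m + 2)))⁻¹)) ζ := by
  set t : ℝ := min (1 / 4) (δ / 16) with ht
  have ht0 : 0 < t := by positivity
  have ht4 : t ≤ 1 / 4 := min_le_left _ _
  have htδ : t ≤ δ / 16 := min_le_right _ _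
  obtain ⟨c, hc0, hc⟩ := exists_le_volume_sbox m ht0
  refine ⟨c * (8 ^ (m + 2))⁻¹, by positivity, fun z w hz hw => ?_⟩
  have hX : 0 < ‖srho2 z w‖ := norm_pos_iff.2 (srho2_ne_zero hz hw)
  set V : ℝ := ((2 * srho w) ^ (m + 2))⁻¹ * ((2 * ‖srho2 z w‖) ^ (2 * (m + 2)))⁻¹ with hV
  set S : Set (SPoint m) := {ζ | 0 < srho ζ ∧ ‖srho2 w ζ - srho ζ‖ < δ * srho ζ} with hS
  have hinv : (volume : Measure (SPoint m)).IsAddLeftInvariant := by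
    rw [Measure.volume_eq_prod]; exact Measure.prod.instIsAddLeftInvariant
  calc ENNReal.ofReal (c * (8 ^ (m + 2))⁻¹ * (‖srho2 z w‖ ^ (2 * (m + 2)))⁻¹)
      = ENNReal.ofReal V * ENNReal.ofReal (c * srho w ^ (m + 2)) := by
        rw [← ENNReal.ofReal_mul (by positivity), hV]
        congr 1
        rw [mul_pow 2 (srho w), mul_pow 2 ‖srho2 z w‖, pow_mul 2,
          show (8 : ℝ) = 2 * 2 ^ 2 by norm_num, mul_pow]
        field_simp
    _ ≤ ENNReal.ofReal V * volume (sbox w t) := by gcongr; exact hc w hw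
    _ = ∫⁻ _ in sbox w t, ENNReal.ofReal V := (setLIntegral_const _ _).symm
    _ ≤ ∫⁻ v in sbox w t, S.indicator (fun ζ => ENNReal.ofReal ((srho ζ ^ (m + 2))⁻¹ *
          (‖srho2 z ζ‖ ^ (2 * (m + 2)))⁻¹)) (w + v) := by
        refine setLIntegral_mono' (measurableSet_sbox w t) fun v hv => ?_
        have h1 := abs_le.1 (abs_srho_add_sub_le ht0 (by linarith) hv)
        have h2 := norm_srho2_add_sub_le hz ht0 hv
        have h3 := norm_srho2_add_sub_le hw ht0 hv
        have htw : t * srho w ≤ 1 / 4 * srho w := by gcongr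
        have htX : t * ‖srho2 z w‖ ≤ 1 / 4 * ‖srho2 z w‖ := by gcongr
        have htδw : t * srho w ≤ δ / 16 * srho w := by gcongr
        have hζ : srho w / 2 ≤ srho (w + v) := by linarith [h1.1]
        have hζ0 : 0 < srho (w + v) := by linarith
        have hmem : w + v ∈ S := by
          refine ⟨hζ0, ?_⟩
          rw [srho2_self, Complex.norm_of_nonneg hw.le] at h3
          have h4 : ‖(srho w : ℂ) - (srho (w + v) : ℂ)‖ ≤ 2 * t * srho w := by
            rw [← Complex.ofReal_sub, Complex.norm_real, Real.norm_eq_abs, abs_sub_comm]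
            exact abs_le.2 h1
          have h5 := norm_add_le (srho2 w (w + v) - srho w) ((srho w : ℂ) - (srho (w + v) : ℂ))
          rw [sub_add_sub_cancel] at h5
          have h6 : δ * (srho w / 2) ≤ δ * srho (w + v) := by gcongr
          have h7 : 0 < δ * srho w := by positivity
          linarith
        rw [Set.indicator_of_mem hmem]
        have hXζ : 0 < ‖srho2 z (w + v)‖ := norm_pos_iff.2 (srho2_ne_zero hz hζ0)
        refine ENNReal.ofReal_le_ofReal ?_
        rw [hV]
        gcongr
        · linarith [h1.2]
        · have := norm_sub_norm_le (srho2 z (w + v)) (srho2 z w)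
          linarith
    _ ≤ _ := (setLIntegral_le_lintegral _ _).trans_eq
        (lintegral_add_left_eq_self (fun ζ => S.indicator (fun ζ => ENNReal.ofReal
          ((srho ζ ^ (m + 2))⁻¹ * (‖srho2 z ζ‖ ^ (2 * (m + 2)))⁻¹)) ζ) w)

/-- A Carleson-type bound on small neighbourhoods gives a bound on the Berezin transform. -/
lemma exists_lintegral_le_of_measure_near_le {m : ℕ} {δ D : ℝ} (hδ : 0 < δ) (hD : 0 ≤ D)
    {ν : Measure (SPoint m)} [SFinite ν] (hν : ∀ᵐ w ∂ν, 0 < srho w)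
    (h : ∀ z : SPoint m, 0 < srho z →
      ν {w | ‖srho2 w z - srho z‖ < δ * srho z} ≤ ENNReal.ofReal (D * srho z ^ (m + 2))) :
    ∃ M : ℝ, 0 ≤ M ∧ ∀ z : SPoint m, 0 < srho z →
      ∫⁻ w, ENNReal.ofReal ((‖srho2 z w‖ ^ (2 * (m + 2)))⁻¹) ∂ν ≤
        ENNReal.ofReal (M * (srho z ^ (m + 2))⁻¹) := by
  obtain ⟨c, hc0, hc⟩ := exists_le_lintegral_near m hδ
  obtain ⟨A, hA0, hA⟩ := exists_lintegral_inv_norm_srho2_le m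
  refine ⟨c⁻¹ * (D * A), by positivity, fun z hz => ?_⟩
  have hs := continuous_srho (m := m)
  have hs2 := continuous_srho2 (m := m)
  set g : SPoint m → ENNReal := fun ζ =>
    ENNReal.ofReal ((srho ζ ^ (m + 2))⁻¹ * (‖srho2 z ζ‖ ^ (2 * (m + 2)))⁻¹) with hg
  have hgm : Measurable g := by
    have hz2 : Measurable fun ζ : SPoint m => srho2 z ζ :=
      (hs2.comp (by fun_prop : Continuous fun ζ : SPoint m => (z, ζ))).measurable
    have := hs.measurable
    fun_prop
  set S : Set (SPoint m × SPoint m) :=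
    {q | 0 < srho q.2 ∧ ‖srho2 q.1 q.2 - srho q.2‖ < δ * srho q.2} with hS
  have hSm : MeasurableSet S := by
    rw [hS, Set.ofPred_and]
    exact ((isOpen_lt (by fun_prop) (by fun_prop)).inter
      (isOpen_lt (by fun_prop) (by fun_prop))).measurableSet
  have hmeas : Measurable (S.indicator fun q => g q.2) :=
    (hgm.comp measurable_snd).indicator hSm
  have hkey : ∫⁻ w, ENNReal.ofReal (c * (‖srho2 z w‖ ^ (2 * (m + 2)))⁻¹) ∂ν ≤
      ENNReal.ofReal D * ENNReal.ofReal (A * (srho z ^ (m + 2))⁻¹) := by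
    calc _ ≤ ∫⁻ w, (∫⁻ ζ, S.indicator (fun q => g q.2) (w, ζ)) ∂ν := by
          refine lintegral_mono_ae (hν.mono fun w hw => (hc z w hz hw).trans_eq ?_)
          rfl
      _ = ∫⁻ ζ, ∫⁻ w, S.indicator (fun q => g q.2) (w, ζ) ∂ν :=
          lintegral_lintegral_swap (f := fun w ζ => S.indicator (fun q => g q.2) (w, ζ))
            hmeas.aemeasurable
      _ ≤ ∫⁻ ζ, (Siegel m).indicator (fun ζ => ENNReal.ofReal D *
            ENNReal.ofReal ((‖srho2 z ζ‖ ^ (2 * (m + 2)))⁻¹)) ζ := by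
          refine lintegral_mono fun ζ => ?_
          by_cases hζ : ζ ∈ Siegel m
          · rw [Set.indicator_of_mem hζ]
            have hζ0 : 0 < srho ζ := hζ
            calc _ = ∫⁻ w, {w | ‖srho2 w ζ - srho ζ‖ < δ * srho ζ}.indicator
                    (fun _ => g ζ) w ∂ν := by
                  refine lintegral_congr fun w => ?_
                  simp only [Set.indicator, hS, Set.mem_ofPred_eq, hζ0, true_and]
              _ ≤ g ζ * ν {w | ‖srho2 w ζ - srho ζ‖ < δ * srho ζ} :=
                  lintegral_indicator_const_le _ _
              _ ≤ g ζ * ENNReal.ofReal (D * srho ζ ^ (m + 2)) := by gcongr; exact h ζ hζ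
              _ = _ := by
                  rw [hg, ← ENNReal.ofReal_mul (by positivity), ← ENNReal.ofReal_mul hD]
                  congr 1
                  field_simp
          · have hζ0 : ¬ 0 < srho ζ := hζ
            simp [Set.indicator, hS, hζ0]
      _ = ENNReal.ofReal D *
            ∫⁻ ζ in Siegel m, ENNReal.ofReal ((‖srho2 z ζ‖ ^ (2 * (m + 2)))⁻¹) := by
          rw [lintegral_indicator (isOpen_siegel m).measurableSet,
            lintegral_const_mul' _ _ ENNReal.ofReal_ne_top]
      _ ≤ _ := by gcongr; exact hA z hz
  calc ∫⁻ w, ENNReal.ofReal ((‖srho2 z w‖ ^ (2 * (m + 2)))⁻¹) ∂ν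
      = ENNReal.ofReal c⁻¹ *
          ∫⁻ w, ENNReal.ofReal (c * (‖srho2 z w‖ ^ (2 * (m + 2)))⁻¹) ∂ν := by
        rw [← lintegral_const_mul' _ _ ENNReal.ofReal_ne_top]
        refine lintegral_congr fun w => ?_
        rw [← ENNReal.ofReal_mul (by positivity), inv_mul_cancel_left₀ hc0.ne']
    _ ≤ ENNReal.ofReal c⁻¹ * (ENNReal.ofReal D * ENNReal.ofReal (A * (srho z ^ (m + 2))⁻¹)) := by
        gcongr
    _ = _ := by
        rw [← ENNReal.ofReal_mul hD, ← ENNReal.ofReal_mul (by positivity)]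
        congr 1
        ring

lemma sFinite_restrict_siegel {m : ℕ} {μ : Measure (SPoint m)} {α : ℝ}
    (hμ : ∫⁻ w in Siegel m, ENNReal.ofReal (‖w.2 + Complex.I‖ ^ (-α)) ∂μ < ⊤) :
    SFinite (μ.restrict (Siegel m)) := by
  have := isFiniteMeasure_withDensity hμ.ne
  refine sFinite_of_absolutelyContinuous (withDensity_absolutelyContinuous'
    (μ := μ.restrict (Siegel m)) (f := fun w => ENNReal.ofReal (‖w.2 + Complex.I‖ ^ (-α))) ?_ ?_)
  · fun_prop
  · refine ae_restrict_of_forall_mem (isOpen_siegel m).measurableSet fun w hw => ?_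
    have := one_pos.trans_le (one_le_norm_add_I hw)
    exact (ENNReal.ofReal_pos.2 (by positivity)).ne'

end

/-- if `T_μ` is bounded on the dense subspace `𝒮_α` of `Aᵖ(𝒰)`, then
the Berezin transform of `μ` is bounded:
`sup_z ρ(z)^{n+1} ∫_𝒰 |ρ(z,w)|^{−2(n+1)} dμ(w) < ∞`. -/
theorem bounded_toeplitz_implies_bounded_berezin (n : ℕ) (hn : 1 ≤ n)
    (p : ℝ) (hp : 1 < p) (α : ℝ) (hα1 : (n : ℝ) + 1 / p < α) (hα2 : α < (n : ℝ) + 1)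
    (μ : Measure (SPoint (n - 1)))
    (hμM : ∃ α₀ : ℝ, 0 < α₀ ∧
      ∫⁻ w in Siegel (n - 1),
        ENNReal.ofReal (‖w.2 + Complex.I‖ ^ (-α₀)) ∂μ < ⊤)
    (C : ℝ) (hC : 0 < C)
    (hT : ∀ f : SPoint (n - 1) → ℂ, SAlpha n α f →
      MemAp n p (fun z => ∫ w in Siegel (n - 1), sK n z w * f w ∂μ) ∧
        bNorm n p (fun z => ∫ w in Siegel (n - 1), sK n z w * f w ∂μ) ≤
          C * bNorm n p f) :
    ∃ M : ℝ, ∀ z ∈ Siegel (n - 1),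
      ∫⁻ w in Siegel (n - 1),
          ENNReal.ofReal (srho z ^ (n + 1) / ‖srho2 z w‖ ^ (2 * (n + 1))) ∂μ ≤
        ENNReal.ofReal M := by
  obtain ⟨m, rfl⟩ : ∃ m, n = m + 1 := ⟨n - 1, by omega⟩
  obtain ⟨α₀, -, hμ⟩ := hμM
  obtain ⟨l, hl⟩ := exists_nat_ge α₀
  have hlk : (l : ℝ) ≤ ((m + 2 + (m + 2 + l) : ℕ) : ℝ) := by
    exact_mod_cast (by omega : l ≤ m + 2 + (m + 2 + l))
  have hαk : α ≤ ((m + 2 + (m + 2 + l) : ℕ) : ℝ) := by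
    refine hα2.le.trans ?_
    exact_mod_cast (by omega : m + 1 + 1 ≤ m + 2 + (m + 2 + l))
  obtain ⟨B, hB0, hB⟩ := exists_lintegral_sq_testFun_le (m := m) (k := m + 2 + l) hp hC hαk
    (hl.trans hlk) (by omega) hμ hT
  obtain ⟨δ, D, hδ, hD0, hD⟩ := exists_measure_near_le hB0 hB
  have hsf : SFinite (μ.restrict (Siegel m)) := sFinite_restrict_siegel hμ
  obtain ⟨M, hM0, hM⟩ := exists_lintegral_le_of_measure_near_le (ν := μ.restrict (Siegel m)) hδ hD0
    (ae_restrict_mem (isOpen_siegel m).measurableSet) hD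
  refine ⟨M, fun z hz => ?_⟩
  have hz0 : 0 < srho z := hz
  calc _ = ENNReal.ofReal (srho z ^ (m + 2)) *
        ∫⁻ w in Siegel m, ENNReal.ofReal ((‖srho2 z w‖ ^ (2 * (m + 2)))⁻¹) ∂μ := by
        rw [← lintegral_const_mul' _ _ ENNReal.ofReal_ne_top]
        refine lintegral_congr fun w => ?_
        rw [← ENNReal.ofReal_mul (by positivity), ← div_eq_mul_inv]
    _ ≤ ENNReal.ofReal (srho z ^ (m + 2)) * ENNReal.ofReal (M * (srho z ^ (m + 2))⁻¹) := by
        gcongr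
        exact hM z hz
    _ = ENNReal.ofReal M := by
        rw [← ENNReal.ofReal_mul (by positivity)]
        congr 1
        field_simp
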